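/- arXiv:1502.02779 — 4 statements merged into one kernel-verified Lean document; each statement's English description precedes it below -/
import Mathlib

section
/- For every x ∈ ℝ^d and every u ∈ M(x): q_i(x,u) ≥ 0 for all i, and |x|² ≤ 2d Σ_{i=1}^d ( q_i(x,u)² + d² (x_i^-)² ), where |x| is the Euclidean norm. -/
open Finset

noncomputable section

/-- `d × d` real matrices represented as functions. -/
abbrev Mat (d : ℕ) := Fin d → Fin d → ℝ

/-- Euclidean space `ℝ^d`. -/
abbrev E (d : ℕ) := EuclideanSpace ℝ (Fin d)

/-- positive part `a⁺ = max(a,0)`. -/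
def pp (a : ℝ) : ℝ := max a 0

/-- negative part `a⁻ = max(-a,0)`. -/
def nn (a : ℝ) : ℝ := max (-a) 0

/-- The control set `M`: nonnegative matrices with zero diagonal whose
column sums (off the diagonal) are at most `1`. -/
def MM (d : ℕ) : Set (Mat d) :=
  {u | (∀ i j, 0 ≤ u i j) ∧ (∀ i, u i i = 0) ∧
    ∀ i, ∑ k ∈ univ.filter (· ≠ i), u k i ≤ 1}

/-- The state-dependent control set `M(x)`. -/
def Mx (d : ℕ) (x : E d) : Set (Mat d) :=
  {u | u ∈ MM d ∧ ∀ i, ∑ j ∈ univ.filter (· ≠ i), u i j * nn (x j) ≤ pp (x i)}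

/-- `q_i(x,u) = x_i⁺ - Σ_{j ≠ i} u_{ij} x_j⁻`. -/
def qf (d : ℕ) (x : E d) (u : Mat d) (i : Fin d) : ℝ :=
  pp (x i) - ∑ j ∈ univ.filter (· ≠ i), u i j * nn (x j)

/-- The square of a real number is the sum of the squares of its positive and negative parts. -/
theorem sq_eq_pp_sq_add_nn_sq (a : ℝ) : a ^ 2 = pp a ^ 2 + nn a ^ 2 := by
  unfold pp nn
  rcases le_total a 0 with h | h
  · rw [max_eq_right h, max_eq_left (by linarith)]
    ring
  · rw [max_eq_left h, max_eq_right (by linarith)]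
    ring

theorem nn_nonneg (a : ℝ) : 0 ≤ nn a := le_max_right _ _

/-- The entries of a control matrix are at most `1`. -/
theorem le_one_of_mem_MM {d : ℕ} {u : Mat d} (hu : u ∈ MM d) {i j : Fin d} (hij : i ≠ j) :
    u i j ≤ 1 :=
  (single_le_sum (f := fun k => u k j) (fun k _ => hu.1 k j) (by simp [hij])).trans (hu.2.2 j)

theorem sq_sum_mul_nn_le {d : ℕ} (x : E d) {u : Mat d} (hu : u ∈ MM d) (i : Fin d) :
    (∑ j ∈ univ.filter (· ≠ i), u i j * nn (x j)) ^ 2 ≤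
      d * (∑ j, nn (x j) ^ 2 - nn (x i) ^ 2) := by
  have hcard : ((univ.filter (· ≠ i)).card : ℝ) ≤ d := by
    exact_mod_cast (card_le_univ _).trans_eq (Fintype.card_fin d)
  have hsplit : ∑ j ∈ univ.filter (· ≠ i), nn (x j) ^ 2 =
      ∑ j, nn (x j) ^ 2 - nn (x i) ^ 2 := by
    rw [filter_ne', ← add_sum_erase univ _ (mem_univ i)]
    ring
  calc (∑ j ∈ univ.filter (· ≠ i), u i j * nn (x j)) ^ 2
      ≤ (∑ j ∈ univ.filter (· ≠ i), nn (x j)) ^ 2 := by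
        refine pow_le_pow_left₀
          (sum_nonneg fun j _ => mul_nonneg (hu.1 i j) (nn_nonneg _)) ?_ 2
        exact sum_le_sum fun j hj => mul_le_of_le_one_left (nn_nonneg _)
          (le_one_of_mem_MM hu (mem_filter.1 hj).2.symm)
    _ ≤ (univ.filter (· ≠ i)).card * ∑ j ∈ univ.filter (· ≠ i), nn (x j) ^ 2 :=
        sq_sum_le_card_mul_sum_sq
    _ ≤ d * ∑ j ∈ univ.filter (· ≠ i), nn (x j) ^ 2 :=
        mul_le_mul_of_nonneg_right hcard (sum_nonneg fun j _ => sq_nonneg _)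
    _ = d * (∑ j, nn (x j) ^ 2 - nn (x i) ^ 2) := by rw [hsplit]

/-- For every `x` and `u ∈ M(x)`: all `q_i(x,u) ≥ 0`, and
`|x|² ≤ 2d Σ_i (q_i(x,u)² + d² (x_i⁻)²)` (Euclidean norm). -/
theorem stmt7 (d : ℕ) (hd : 1 ≤ d) (x : E d) (u : Mat d) (hu : u ∈ Mx d x) :
    (∀ i, 0 ≤ qf d x u i) ∧
      ‖x‖ ^ 2 ≤ 2 * d * ∑ i, (qf d x u i ^ 2 + d ^ 2 * nn (x i) ^ 2) := by
  refine ⟨fun i => sub_nonneg.2 (hu.2 i), ?_⟩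
  have hcoord (i : Fin d) : x i ^ 2 ≤ 2 * qf d x u i ^ 2 +
      2 * (d * (∑ j, nn (x j) ^ 2 - nn (x i) ^ 2)) + nn (x i) ^ 2 := by
    have hs := sq_sum_mul_nn_le x hu.1 i
    rw [sq_eq_pp_sq_add_nn_sq (x i)]
    unfold qf
    set s := ∑ j ∈ univ.filter (· ≠ i), u i j * nn (x j)
    nlinarith [sq_nonneg (pp (x i) - s - s)]
  have hsum := sum_le_sum fun i (_ : i ∈ univ) => hcoord i
  rw [EuclideanSpace.real_norm_sq_eq]
  refine hsum.trans ?_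
  simp only [sum_add_distrib, ← mul_sum, sum_sub_distrib, sum_const, card_univ,
    Fintype.card_fin, nsmul_eq_mul]
  have hQ : 0 ≤ ∑ i, qf d x u i ^ 2 := sum_nonneg fun i _ => sq_nonneg _
  have hN : 0 ≤ ∑ i, nn (x i) ^ 2 := sum_nonneg fun i _ => sq_nonneg _
  have hd' : (1 : ℝ) ≤ d := by exact_mod_cast hd
  have hcoeff : 0 ≤ 2 * (d : ℝ) ^ 2 * (d - 1) + (2 * d - 1) := by
    have := mul_nonneg (sq_nonneg (d : ℝ)) (sub_nonneg.2 hd')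
    linarith
  nlinarith [mul_nonneg (sub_nonneg.2 hd') hQ, mul_nonneg hcoeff hN]
end
end

section
/- For every compact set K ⊂ ℝ^d there exists a constant θ_1 > 0 (depending on K) such that for all x, y ∈ K and every u ∈ M(y) there exists ū ∈ M(x) with |u_{ij} y_j^- - ū_{ij} x_j^-| ≤ θ_1 |x-y|^{1/2} for all i ≠ j. -/
open Finset

noncomputable section

/-- Lowering each of finitely many nonnegative numbers by `δ`, truncated at `0`, lowers their sum
by at least `δ` unless all truncated values vanish. -/
theorem sum_max_sub_le {ι : Type*} [DecidableEq ι] (s : Finset ι) (w : ι → ℝ) {A B δ : ℝ}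
    (hw : ∀ i, 0 ≤ w i) (hδ : 0 ≤ δ) (hA : ∑ i ∈ s, w i ≤ A) (hAB : A ≤ B + δ) (hB : 0 ≤ B) :
    ∑ i ∈ s, max (w i - δ) 0 ≤ B := by
  by_cases h : ∃ i ∈ s, δ < w i
  · obtain ⟨i, hi, hlt⟩ := h
    have h1 := add_sum_erase s (fun i => max (w i - δ) 0) hi
    have h2 := add_sum_erase s w hi
    have h3 : ∑ k ∈ s.erase i, max (w k - δ) 0 ≤ ∑ k ∈ s.erase i, w k :=
      sum_le_sum fun k _ => max_le (by linarith) (hw k)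
    have h4 : max (w i - δ) 0 = w i - δ := max_eq_left (by linarith)
    simp only [h4] at h1
    linarith
  · push Not at h
    rw [sum_eq_zero fun i hi => max_eq_right (by linarith [h i hi])]
    exact hB

theorem nn_le_add_abs (a b : ℝ) : nn a ≤ nn b + |b - a| :=
  max_le (by linarith [le_abs_self (b - a), show -b ≤ nn b from le_max_left _ _])
    (add_nonneg (nn_nonneg b) (abs_nonneg _))

theorem pp_nonneg (a : ℝ) : 0 ≤ pp a := le_max_right _ _

theorem pp_le_add_abs (a b : ℝ) : pp a ≤ pp b + |b - a| :=
  max_le (by linarith [neg_abs_le (b - a), show b ≤ pp b from le_max_left _ _])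
    (add_nonneg (pp_nonneg b) (abs_nonneg _))

/-- The sets `M(x)` depend on `x` in a Lipschitz way, measured through the flows `u_{ij} x_j⁻`. -/
theorem exists_mem_Mx_abs_sub_le (d : ℕ) (x y : E d) (u : Mat d) (hu : u ∈ Mx d y) :
    ∃ v ∈ Mx d x, ∀ i j, |u i j * nn (y j) - v i j * nn (x j)| ≤ ‖x - y‖ := by
  obtain ⟨⟨hu0, hud, huc⟩, hur⟩ := hu
  set δ := ‖x - y‖
  have hδ : 0 ≤ δ := norm_nonneg _
  have hcoord : ∀ i, |x i - y i| ≤ δ := fun i => by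
    simpa using PiLp.norm_apply_le (x - y) i
  have hw : ∀ i j, 0 ≤ u i j * nn (y j) := fun i j => mul_nonneg (hu0 i j) (nn_nonneg _)
  let z : Mat d := fun i j => max (u i j * nn (y j) - δ) 0
  have hz : ∀ i j, 0 ≤ z i j := fun i j => le_max_right _ _
  have hzd : ∀ i, z i i = 0 := fun i => by
    simp [z, hud, hδ]
  have hcol : ∀ j, ∑ k ∈ univ.filter (· ≠ j), z k j ≤ nn (x j) := fun j => by
    refine sum_max_sub_le _ (fun k => u k j * nn (y j)) (A := nn (y j)) (fun k => hw k j) hδ ?_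
      ((nn_le_add_abs _ (x j)).trans (by linarith [hcoord j])) (nn_nonneg _)
    rw [← sum_mul]
    exact mul_le_of_le_one_left (nn_nonneg _) (huc j)
  have hrow : ∀ i, ∑ j ∈ univ.filter (· ≠ i), z i j ≤ pp (x i) := fun i =>
    sum_max_sub_le _ (fun j => u i j * nn (y j)) (fun j => hw i j) hδ (hur i)
      ((pp_le_add_abs _ (x i)).trans (by linarith [hcoord i])) (pp_nonneg _)
  have hzle : ∀ i j, z i j ≤ nn (x j) := fun i j => by
    rcases eq_or_ne i j with rfl | h
    · rw [hzd]
      exact nn_nonneg _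
    · exact (single_le_sum (f := fun k => z k j) (fun k _ => hz k j)
        (by simpa using h)).trans (hcol j)
  have hflow : ∀ i j, z i j / nn (x j) * nn (x j) = z i j := fun i j =>
    div_mul_cancel_of_imp fun h => le_antisymm (h ▸ hzle i j) (hz i j)
  refine ⟨fun i j => z i j / nn (x j), ⟨⟨fun i j => div_nonneg (hz i j) (nn_nonneg _),
    fun i => by simp [hzd], fun j => ?_⟩, fun i => ?_⟩, fun i j => ?_⟩
  · rw [← sum_div]
    exact div_le_one_of_le₀ (hcol j) (nn_nonneg _)
  · simpa only [hflow] using hrow i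
  · simp only [hflow, z]
    have := hw i j
    rcases max_cases (u i j * nn (y j) - δ) 0 with h | h <;> rw [h.1, abs_le] <;>
      constructor <;> linarith

/-- For every compact `K ⊂ ℝ^d` there is `θ₁ > 0` such that for all `x, y ∈ K`
and every `u ∈ M(y)` there exists `ū ∈ M(x)` with
`|u_{ij} y_j⁻ - ū_{ij} x_j⁻| ≤ θ₁ |x-y|^{1/2}` for all `i ≠ j`. -/
theorem stmt13 (d : ℕ) (hd : 1 ≤ d) (K : Set (E d)) (hK : IsCompact K) :
    ∃ θ₁ > (0 : ℝ), ∀ x ∈ K, ∀ y ∈ K, ∀ u ∈ Mx d y, ∃ v ∈ Mx d x,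
      ∀ i j, i ≠ j → |u i j * nn (y j) - v i j * nn (x j)| ≤ θ₁ * ‖x - y‖ ^ ((1 : ℝ) / 2) := by
  obtain ⟨C, hC, hKC⟩ := hK.isBounded.exists_pos_norm_le
  refine ⟨(2 * C) ^ ((1 : ℝ) / 2), by positivity, fun x hx y hy u hu => ?_⟩
  obtain ⟨v, hv, hvu⟩ := exists_mem_Mx_abs_sub_le d x y u hu
  refine ⟨v, hv, fun i j _ => (hvu i j).trans ?_⟩
  have hle : ‖x - y‖ ≤ 2 * C := (norm_sub_le x y).trans (by linarith [hKC x hx, hKC y hy])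
  calc ‖x - y‖ = ‖x - y‖ ^ ((1 : ℝ) / 2) * ‖x - y‖ ^ ((1 : ℝ) / 2) := by
        rw [← Real.sqrt_eq_rpow, Real.mul_self_sqrt (norm_nonneg _)]
    _ ≤ _ := by gcongr
end
end

section
/- Let (a_n)_{n ≥ 1} be a sequence of nonnegative real numbers. Then limsup_{β → 1^-} (1-β) Σ_{n=1}^∞ β^n a_n ≤ limsup_{N → ∞} (1/N) Σ_{n=1}^N a_n. -/
open Filter
open scoped ENNReal

/-- The Cauchy product formula for series in `[0,∞]`. -/
theorem ENNReal.tsum_mul_tsum_eq_tsum_sum_range (f g : ℕ → ℝ≥0∞) :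
    (∑' n, f n) * ∑' n, g n = ∑' k, ∑ n ∈ Finset.range (k + 1), f n * g (k - n) := by
  simp_rw [← Finset.Nat.sum_antidiagonal_eq_sum_range_succ (fun i j => f i * g j),
    ← Finset.tsum_subtype]
  rw [← ENNReal.tsum_sigma' (fun x : Σ k : ℕ, Finset.HasAntidiagonal.antidiagonal k =>
      f (x.2 : ℕ × ℕ).1 * g (x.2 : ℕ × ℕ).2),
    ← Finset.HasAntidiagonal.sigmaAntidiagonalEquivProd.symm.tsum_eq, ENNReal.tsum_prod']
  simp [ENNReal.tsum_mul_left, ENNReal.tsum_mul_right]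

/-- Summation by parts for power series with coefficients in `[0,∞]`. -/
theorem ENNReal.tsum_pow_mul_eq_one_sub_mul_tsum (b : ℕ → ℝ≥0∞) {r : ℝ≥0∞} (hr : r < 1) :
    ∑' n, r ^ n * b n = (1 - r) * ∑' k, r ^ k * ∑ n ∈ Finset.range (k + 1), b n := by
  have h : ∑' k, r ^ k * ∑ n ∈ Finset.range (k + 1), b n =
      (∑' n, r ^ n * b n) * (1 - r)⁻¹ := by
    rw [← ENNReal.tsum_geometric, ENNReal.tsum_mul_tsum_eq_tsum_sum_range]
    refine tsum_congr fun k => ?_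
    rw [Finset.mul_sum]
    refine Finset.sum_congr rfl fun n hn => ?_
    rw [mul_right_comm, ← pow_add, Nat.add_sub_cancel' (Finset.mem_range_succ_iff.1 hn)]
  rw [h, mul_left_comm, ENNReal.mul_inv_cancel (tsub_pos_of_lt hr).ne' (by simp), mul_one]

/-- An affine bound on the partial sums bounds the Abel means. -/
theorem ENNReal.one_sub_mul_tsum_pow_mul_le (b : ℕ → ℝ≥0∞) {r C L : ℝ≥0∞} (hr : r < 1)
    (hb : ∀ k, ∑ n ∈ Finset.range (k + 1), b n ≤ C + L * (k + 1)) :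
    (1 - r) * ∑' n, r ^ n * b n ≤ (1 - r) * C + L := by
  have hinv : (1 - r) * (1 - r)⁻¹ = 1 :=
    ENNReal.mul_inv_cancel (tsub_pos_of_lt hr).ne' (by simp)
  have hlin : (1 - r) * ∑' k : ℕ, r ^ k * (k + 1) = (1 - r)⁻¹ := by
    have h := ENNReal.tsum_pow_mul_eq_one_sub_mul_tsum (fun _ => 1) hr
    simpa [ENNReal.tsum_geometric] using h.symm
  calc (1 - r) * ∑' n, r ^ n * b n
      = (1 - r) * ((1 - r) * ∑' k, r ^ k * ∑ n ∈ Finset.range (k + 1), b n) := by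
        rw [ENNReal.tsum_pow_mul_eq_one_sub_mul_tsum b hr]
    _ ≤ (1 - r) * ((1 - r) * ∑' k : ℕ, r ^ k * (C + L * (k + 1))) := by
        gcongr with k
        exact hb k
    _ = (1 - r) * ((1 - r) * ((1 - r)⁻¹ * C + L * ∑' k : ℕ, r ^ k * (k + 1))) := by
        simp_rw [mul_add (r ^ _) C, mul_left_comm (r ^ _) L]
        rw [ENNReal.tsum_add, ENNReal.tsum_mul_right, ENNReal.tsum_mul_left,
          ENNReal.tsum_geometric]
    _ = (1 - r) * ((1 - r) * (1 - r)⁻¹ * C + L * ((1 - r) * ∑' k : ℕ, r ^ k * (k + 1))) := by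
        ring
    _ = (1 - r) * C + L := by
        rw [hlin, hinv, one_mul, mul_add, mul_left_comm, hinv, mul_one]

/-- Hardy–Littlewood Abelian bound: for a sequence of nonnegative reals `(a_n)_{n ≥ 1}`,
`limsup_{β → 1⁻} (1-β) Σ_{n=1}^∞ β^n a_n ≤ limsup_{N → ∞} (1/N) Σ_{n=1}^N a_n`,
with both sides interpreted in `[0,∞]`. -/
theorem stmt16 (a : ℕ → ℝ) (ha : ∀ n, 0 ≤ a n) :
    limsup (fun β : ℝ =>
        ENNReal.ofReal (1 - β) * ∑' n : ℕ, ENNReal.ofReal (β ^ (n + 1) * a (n + 1)))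
      (nhdsWithin 1 (Set.Iio 1)) ≤
    limsup (fun N : ℕ =>
        (∑ n ∈ Finset.Icc 1 N, ENNReal.ofReal (a n)) / (N : ℝ≥0∞)) atTop := by
  refine le_of_forall_gt_imp_ge_of_dense fun L hL => ?_
  obtain ⟨N₀, hN₀⟩ := eventually_atTop.1 (eventually_lt_of_limsup_lt hL)
  set C : ℝ≥0∞ := ∑ n ∈ Finset.Icc 1 N₀, ENNReal.ofReal (a n) with hC
  have hCtop : C ≠ ∞ := ENNReal.sum_ne_top.2 fun _ _ => ENNReal.ofReal_ne_top
  have hbound (k : ℕ) :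
      ∑ n ∈ Finset.range (k + 1), ENNReal.ofReal (a (n + 1)) ≤ C + L * (k + 1) := by
    have hshift : ∑ n ∈ Finset.range (k + 1), ENNReal.ofReal (a (n + 1)) =
        ∑ n ∈ Finset.Icc 1 (k + 1), ENNReal.ofReal (a n) := by
      rw [Finset.range_eq_Ico, Finset.sum_Ico_add' (fun n => ENNReal.ofReal (a n)) 0 (k + 1) 1]
      rfl
    rw [hshift]
    rcases le_total N₀ (k + 1) with h | h
    · have h' := (hN₀ _ h).le
      rw [ENNReal.div_le_iff (by simp) (by simp)] at h'
      push_cast at h'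
      exact h'.trans le_add_self
    · exact (Finset.sum_le_sum_of_subset (Finset.Icc_subset_Icc_right h)).trans le_self_add
  have hlim : Tendsto (fun β : ℝ => ENNReal.ofReal (1 - β) * C + L)
      (nhdsWithin 1 (Set.Iio 1)) (nhds L) := by
    have h1 : Tendsto (fun β : ℝ => ENNReal.ofReal (1 - β)) (nhdsWithin 1 (Set.Iio 1))
        (nhds 0) := by
      have h : Continuous fun β : ℝ => ENNReal.ofReal (1 - β) :=
        ENNReal.continuous_ofReal.comp (continuous_const.sub continuous_id)
      simpa using (h.tendsto 1).mono_left nhdsWithin_le_nhds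
    simpa using (ENNReal.Tendsto.mul_const h1 (Or.inr hCtop)).add_const L
  rw [← hlim.limsup_eq]
  refine limsup_le_limsup ?_
  filter_upwards [Ioo_mem_nhdsLT (zero_lt_one' ℝ)] with β hβ
  have hr : ENNReal.ofReal β < 1 := by simpa using hβ.2
  have hsub : ENNReal.ofReal (1 - β) = 1 - ENNReal.ofReal β := by
    rw [ENNReal.ofReal_sub _ hβ.1.le, ENNReal.ofReal_one]
  rw [hsub]
  refine le_trans ?_ (ENNReal.one_sub_mul_tsum_pow_mul_le _ hr hbound)
  gcongr with n
  rw [← ENNReal.ofReal_pow hβ.1.le, ← ENNReal.ofReal_mul (pow_nonneg hβ.1.le n)]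
  have := ha (n + 1)
  exact ENNReal.ofReal_le_ofReal (mul_le_mul_of_nonneg_right
    (pow_le_pow_of_le_one hβ.1.le hβ.2.le n.le_succ) this)
end

section
/- Let f : [0,∞) → [0,∞) be locally integrable. Then limsup_{α → 0^+} (1 - e^{-α}) e^{-α} ∫_0^∞ e^{-αs} f(s) ds ≤ limsup_{T → ∞} (1/T) ∫_0^T f(s) ds; in particular limsup_{α → 0^+} α ∫_0^∞ e^{-αs} f(s) ds ≤ limsup_{T → ∞} (1/T) ∫_0^T f(s) ds. -/
open Filter MeasureTheory
open scoped ENNReal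

theorem lintegral_Ioi_mul_exp_neg {α : ℝ} (hα : 0 < α) (s : ℝ) :
    ∫⁻ t in Set.Ioi s, ENNReal.ofReal (α * Real.exp (-α * t)) =
      ENNReal.ofReal (Real.exp (-α * s)) := by
  rw [← ofReal_integral_eq_lintegral_ofReal]
  · rw [integral_const_mul, integral_exp_mul_Ioi (by linarith)]
    congr 1
    field_simp
  · exact (integrableOn_exp_mul_Ioi (by linarith) s).const_mul α
  · exact ae_of_all _ fun t => by positivity

/-- The Laplace transform as a weighted integral of the primitive. -/
theorem lintegral_exp_neg_mul_eq {α : ℝ} (hα : 0 < α) {g : ℝ → ℝ≥0∞}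
    (hg : AEMeasurable g (volume.restrict (Set.Ioi 0))) :
    ∫⁻ s in Set.Ioi (0 : ℝ), ENNReal.ofReal (Real.exp (-α * s)) * g s =
      ∫⁻ t in Set.Ioi (0 : ℝ),
        ENNReal.ofReal (α * Real.exp (-α * t)) * ∫⁻ s in Set.Ioo 0 t, g s := by
  set k : ℝ → ℝ≥0∞ := fun t => ENNReal.ofReal (α * Real.exp (-α * t)) with hk
  have hkm : Measurable k := by fun_prop
  have hS : MeasurableSet {p : ℝ × ℝ | p.1 < p.2} := measurableSet_lt measurable_fst measurable_snd
  calc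
    _ = ∫⁻ s in Set.Ioi (0 : ℝ), ∫⁻ t in Set.Ioi (0 : ℝ),
          {p : ℝ × ℝ | p.1 < p.2}.indicator (fun p => k p.2 * g p.1) (s, t) := by
      refine setLIntegral_congr_fun measurableSet_Ioi fun s hs => ?_
      have h : (fun t => {p : ℝ × ℝ | p.1 < p.2}.indicator (fun p => k p.2 * g p.1) (s, t)) =
          (Set.Ioi s).indicator fun t => k t * g s := by
        ext t; simp [Set.indicator]
      simp only [h]
      rw [lintegral_indicator measurableSet_Ioi, Measure.restrict_restrict measurableSet_Ioi,
        Set.Ioi_inter_Ioi, sup_eq_left.2 (le_of_lt hs), lintegral_mul_const _ hkm,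
        lintegral_Ioi_mul_exp_neg hα]
    _ = ∫⁻ t in Set.Ioi (0 : ℝ), ∫⁻ s in Set.Ioi (0 : ℝ),
          {p : ℝ × ℝ | p.1 < p.2}.indicator (fun p => k p.2 * g p.1) (s, t) := by
      refine lintegral_lintegral_swap (AEMeasurable.indicator ?_ hS)
      exact (hkm.comp measurable_snd).aemeasurable.mul hg.comp_fst
    _ = _ := by
      refine setLIntegral_congr_fun measurableSet_Ioi fun t _ => ?_
      have h : (fun s => {p : ℝ × ℝ | p.1 < p.2}.indicator (fun p => k p.2 * g p.1) (s, t)) =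
          (Set.Iio t).indicator fun s => k t * g s := by
        ext s; simp [Set.indicator]
      simp only [h]
      rw [lintegral_indicator measurableSet_Iio, Measure.restrict_restrict measurableSet_Iio,
        Set.inter_comm, Set.Ioi_inter_Iio, lintegral_const_mul' _ _ ENNReal.ofReal_ne_top]

theorem mul_lintegral_exp_neg_le {α : ℝ} (hα : 0 < α) {g : ℝ → ℝ≥0∞}
    (hg : AEMeasurable g (volume.restrict (Set.Ioi 0))) {A c : ℝ≥0∞}
    (h : ∀ t, 0 < t → ∫⁻ s in Set.Ioo 0 t, g s ≤ A + c * ENNReal.ofReal t) :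
    ENNReal.ofReal α * ∫⁻ s in Set.Ioi (0 : ℝ), ENNReal.ofReal (Real.exp (-α * s)) * g s ≤
      ENNReal.ofReal α * A + c := by
  have hone := lintegral_exp_neg_mul_eq hα (g := fun _ => 1) aemeasurable_const
  simp only [mul_one, lintegral_const, MeasurableSet.univ, Measure.restrict_apply,
    Set.univ_inter, Real.volume_Ioo, sub_zero, one_mul] at hone
  have hexp : ENNReal.ofReal α * ∫⁻ s in Set.Ioi (0 : ℝ), ENNReal.ofReal (Real.exp (-α * s)) =
      1 := by
    rw [← lintegral_const_mul' _ _ ENNReal.ofReal_ne_top]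
    simp_rw [← ENNReal.ofReal_mul hα.le]
    rw [lintegral_Ioi_mul_exp_neg hα]
    simp
  calc
    _ = ENNReal.ofReal α * ∫⁻ t in Set.Ioi (0 : ℝ),
          ENNReal.ofReal (α * Real.exp (-α * t)) * ∫⁻ s in Set.Ioo 0 t, g s := by
      rw [lintegral_exp_neg_mul_eq hα hg]
    _ ≤ ENNReal.ofReal α * ∫⁻ t in Set.Ioi (0 : ℝ),
          (ENNReal.ofReal (α * Real.exp (-α * t)) * A +
            c * (ENNReal.ofReal (α * Real.exp (-α * t)) * ENNReal.ofReal t)) := by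
      gcongr ENNReal.ofReal α * ?_
      refine setLIntegral_mono' measurableSet_Ioi fun t ht => ?_
      refine (mul_le_mul_right (h t ht) _).trans_eq ?_
      ring
    _ = ENNReal.ofReal α * A + c := by
      rw [lintegral_add_left (by fun_prop), lintegral_mul_const _ (by fun_prop),
        lintegral_const_mul _ (by fun_prop), ← hone, lintegral_Ioi_mul_exp_neg hα, mul_add,
        mul_left_comm _ c, hexp]
      simp

/-- Abelian bound for the Laplace transform of a nonnegative locally integrable function. -/
theorem limsup_mul_lintegral_exp_neg_le (f : ℝ → ℝ) (hf : ∀ s, 0 ≤ f s)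
    (hloc : LocallyIntegrableOn f (Set.Ici 0)) :
    limsup (fun α : ℝ =>
        ENNReal.ofReal α *
          ∫⁻ s in Set.Ioi (0 : ℝ), ENNReal.ofReal (Real.exp (-α * s) * f s))
        (nhdsWithin 0 (Set.Ioi 0)) ≤
      limsup (fun T : ℝ => ENNReal.ofReal ((1 / T) * ∫ s in (0:ℝ)..T, f s)) atTop := by
  refine le_of_forall_gt_imp_ge_of_dense fun c hc => ?_
  obtain ⟨T₀, hT₀⟩ := eventually_atTop.1 (eventually_lt_of_limsup_lt hc)
  have hg : AEMeasurable (fun s => ENNReal.ofReal (f s)) (volume.restrict (Set.Ioi 0)) :=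
    ((hloc.mono_set Set.Ioi_subset_Ici_self).aestronglyMeasurable).aemeasurable.ennreal_ofReal
  have hint (T : ℝ) : IntegrableOn f (Set.Ioc 0 T) :=
    (hloc.integrableOn_compact_subset Set.Icc_subset_Ici_self isCompact_Icc).mono_set
      Set.Ioc_subset_Icc_self
  have hprim (T : ℝ) (hT : 0 ≤ T) : ∫⁻ s in Set.Ioo 0 T, ENNReal.ofReal (f s) =
      ENNReal.ofReal (∫ s in (0:ℝ)..T, f s) := by
    rw [intervalIntegral.integral_of_le hT,
      ofReal_integral_eq_lintegral_ofReal (hint T) (ae_of_all _ hf),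
      restrict_Ioo_eq_restrict_Ioc]
  set A : ℝ≥0∞ := ∫⁻ s in Set.Ioo 0 (max T₀ 0), ENNReal.ofReal (f s) with hA
  have hAtop : A ≠ ∞ := by
    rw [hA, hprim _ (le_max_right _ _)]
    exact ENNReal.ofReal_ne_top
  have hbound (t : ℝ) (ht : 0 < t) :
      ∫⁻ s in Set.Ioo 0 t, ENNReal.ofReal (f s) ≤ A + c * ENNReal.ofReal t := by
    rcases le_total T₀ t with h | h
    · refine le_add_left ?_
      rw [hprim t ht.le]
      calc
        _ = ENNReal.ofReal ((1 / t) * ∫ s in (0:ℝ)..t, f s) * ENNReal.ofReal t := by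
          rw [← ENNReal.ofReal_mul' ht.le]
          congr 1
          field_simp
        _ ≤ _ := by gcongr; exact (hT₀ t h).le
    · exact le_add_right
        (lintegral_mono_set (Set.Ioo_subset_Ioo_right (h.trans (le_max_left _ _))))
  have hle : ∀ᶠ α : ℝ in nhdsWithin 0 (Set.Ioi 0),
      ENNReal.ofReal α * ∫⁻ s in Set.Ioi (0 : ℝ), ENNReal.ofReal (Real.exp (-α * s) * f s) ≤
        ENNReal.ofReal α * A + c := by
    filter_upwards [self_mem_nhdsWithin] with α hα
    simp_rw [ENNReal.ofReal_mul (Real.exp_pos _).le]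
    exact mul_lintegral_exp_neg_le hα hg hbound
  have hlim : Tendsto (fun α : ℝ => ENNReal.ofReal α * A + c) (nhdsWithin 0 (Set.Ioi 0))
      (nhds c) := by
    have h₀ : Tendsto ENNReal.ofReal (nhdsWithin 0 (Set.Ioi 0)) (nhds 0) := by
      simpa using (ENNReal.continuous_ofReal.tendsto 0).mono_left nhdsWithin_le_nhds
    simpa using (ENNReal.Tendsto.mul_const h₀ (Or.inr hAtop)).add_const c
  exact (limsup_le_limsup hle).trans_eq hlim.limsup_eq

/-- Abelian bound for Laplace transforms: for nonnegative locally integrable `f` on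
`[0,∞)`, `limsup_{α → 0⁺} (1 - e^{-α}) e^{-α} ∫₀^∞ e^{-αs} f(s) ds ≤
limsup_{T → ∞} (1/T) ∫₀^T f(s) ds`; in particular
`limsup_{α → 0⁺} α ∫₀^∞ e^{-αs} f(s) ds ≤ limsup_{T → ∞} (1/T) ∫₀^T f(s) ds`,
all in `[0,∞]`. -/
theorem stmt19 (f : ℝ → ℝ) (hf : ∀ s, 0 ≤ f s)
    (hloc : LocallyIntegrableOn f (Set.Ici 0)) :
    (limsup (fun α : ℝ =>
        ENNReal.ofReal ((1 - Real.exp (-α)) * Real.exp (-α)) *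
          ∫⁻ s in Set.Ioi (0 : ℝ), ENNReal.ofReal (Real.exp (-α * s) * f s))
        (nhdsWithin 0 (Set.Ioi 0)) ≤
      limsup (fun T : ℝ => ENNReal.ofReal ((1 / T) * ∫ s in (0:ℝ)..T, f s)) atTop) ∧
    (limsup (fun α : ℝ =>
        ENNReal.ofReal α *
          ∫⁻ s in Set.Ioi (0 : ℝ), ENNReal.ofReal (Real.exp (-α * s) * f s))
        (nhdsWithin 0 (Set.Ioi 0)) ≤
      limsup (fun T : ℝ => ENNReal.ofReal ((1 / T) * ∫ s in (0:ℝ)..T, f s)) atTop) := by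
  have h := limsup_mul_lintegral_exp_neg_le f hf hloc
  refine ⟨(limsup_le_limsup ?_).trans h, h⟩
  filter_upwards [self_mem_nhdsWithin] with α hα
  gcongr
  have hα : 0 < α := hα
  have h₁ : 1 - Real.exp (-α) ≤ α := by linarith [Real.add_one_le_exp (-α)]
  have h₂ : Real.exp (-α) ≤ 1 := Real.exp_le_one_iff.2 (by linarith)
  nlinarith [Real.exp_pos (-α)]
end
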